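/- In Version A of generalized one-or-one-or-one-of-both, a position is a P-position if and only if every pile size is even. -/

import Mathlib

/-- Legal moves of Version A: choose a nonempty sub-multiset `S` of the piles and
remove one token from each chosen pile (piles reaching size 0 are deleted). -/
inductive MoveA : Multiset ℕ → Multiset ℕ → Prop
  | mk {G S : Multiset ℕ} (hS : S ≤ G) (hne : S ≠ 0) :
      MoveA G ((G - S) + (S.map (· - 1)).filter (· ≠ 0))

mutual
  /-- P-positions of Version A under normal play: every move leads to an N-position
  (in particular the empty position is a P-position).  Since every move strictly
  decreases the total number of tokens, this inductive definition agrees with the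
  usual recursive definition of outcome classes. -/
  inductive PPosA : Multiset ℕ → Prop
    | mk : ∀ {G : Multiset ℕ}, (∀ H, MoveA G H → NPosA H) → PPosA G
  /-- N-positions of Version A under normal play: some move leads to a P-position. -/
  inductive NPosA : Multiset ℕ → Prop
    | mk : ∀ {G H : Multiset ℕ}, MoveA G H → PPosA H → NPosA G
end

theorem Multiset.sum_filter_ne_zero_eq (T : Multiset ℕ) : (T.filter (· ≠ 0)).sum = T.sum := by
  induction T using Multiset.induction with
  | empty => rfl
  | cons a T ih =>
    by_cases h : a = 0
    · simpa [h] using ih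
    · simpa [h] using ih

theorem MoveA.zero_notMem {G H : Multiset ℕ} (hG : 0 ∉ G) (h : MoveA G H) : 0 ∉ H := by
  obtain ⟨hS, _⟩ := h
  rw [Multiset.mem_add, not_or]
  exact ⟨fun h0 => hG (Multiset.mem_of_le (Multiset.sub_le_self _ _) h0), by simp⟩

theorem MoveA.sum_lt {G H : Multiset ℕ} (hG : 0 ∉ G) (h : MoveA G H) : H.sum < G.sum := by
  obtain @⟨S, hS, hne⟩ := h
  have hlt : (S.map (· - 1)).sum < (S.map id).sum := by
    refine Multiset.sum_lt_sum_of_nonempty hne fun p hp => ?_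
    have : p ≠ 0 := fun h0 => hG (h0 ▸ Multiset.mem_of_le hS hp)
    simp only [id]
    omega
  have hsum : (G - S).sum + S.sum = G.sum := by
    rw [← Multiset.sum_add, Multiset.sub_add_cancel hS]
  rw [Multiset.map_id] at hlt
  rw [Multiset.sum_add, Multiset.sum_filter_ne_zero_eq]
  omega

/-- Every move from an all-even position leaves an odd pile. -/
theorem MoveA.not_forall_even {G H : Multiset ℕ} (hG : 0 ∉ G) (hev : ∀ p ∈ G, Even p)
    (h : MoveA G H) : ¬ ∀ p ∈ H, Even p := by
  obtain @⟨S, hS, hne⟩ := h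
  obtain ⟨p, hp⟩ := Multiset.exists_mem_of_ne_zero hne
  have hpG := Multiset.mem_of_le hS hp
  have hp0 : p ≠ 0 := fun h0 => hG (h0 ▸ hpG)
  obtain ⟨k, hk⟩ := hev p hpG
  intro hall
  obtain ⟨m, hm⟩ := hall (p - 1) <| Multiset.mem_add.2 <| Or.inr <|
    Multiset.mem_filter.2 ⟨Multiset.mem_map_of_mem _ hp, by omega⟩
  omega

/-- If some pile is odd, removing a token from every odd pile makes all piles even. -/
theorem exists_moveA_forall_even {G : Multiset ℕ} (hodd : ¬ ∀ p ∈ G, Even p) :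
    ∃ H, MoveA G H ∧ ∀ p ∈ H, Even p := by
  push Not at hodd
  obtain ⟨q, hq, hqo⟩ := hodd
  have hne : G.filter (fun p => ¬ Even p) ≠ 0 := fun h0 =>
    Multiset.notMem_zero q (h0 ▸ Multiset.mem_filter.2 ⟨hq, hqo⟩)
  refine ⟨_, MoveA.mk (Multiset.filter_le _ G) hne, fun p hp => ?_⟩
  rcases Multiset.mem_add.1 hp with hp | hp
  · rw [tsub_eq_of_eq_add (Multiset.filter_add_not (fun p => Even p) G).symm] at hp
    exact (Multiset.mem_filter.1 hp).2
  · obtain ⟨r, hr, rfl⟩ := Multiset.mem_map.1 (Multiset.mem_filter.1 hp).1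
    exact (Nat.not_even_iff_odd.1 (Multiset.mem_filter.1 hr).2).tsub_odd odd_one

/-- The outcome classes of Version A are characterised together, by induction on the total
number of tokens. -/
theorem pPosA_iff_and_nPosA_iff (G : Multiset ℕ) (hG : 0 ∉ G) :
    (PPosA G ↔ ∀ p ∈ G, Even p) ∧ (NPosA G ↔ ¬ ∀ p ∈ G, Even p) := by
  induction hn : G.sum using Nat.strong_induction_on generalizing G with
  | _ n ih =>
    subst hn
    have ih' (H : Multiset ℕ) (h : MoveA G H) := ih _ (h.sum_lt hG) H (h.zero_notMem hG) rfl
    refine ⟨⟨fun hP => ?_, fun hev => ?_⟩, ⟨fun hN => ?_, fun hodd => ?_⟩⟩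
    · by_contra hodd
      obtain ⟨H, hm, hH⟩ := exists_moveA_forall_even hodd
      obtain ⟨hP⟩ := hP
      exact (ih' H hm).2.1 (hP H hm) hH
    · exact PPosA.mk fun H hm => (ih' H hm).2.2 (hm.not_forall_even hG hev)
    · obtain ⟨hm, hH⟩ := hN
      exact fun hev => hm.not_forall_even hG hev ((ih' _ hm).1.1 hH)
    · obtain ⟨H, hm, hH⟩ := exists_moveA_forall_even hodd
      exact NPosA.mk hm ((ih' H hm).1.2 hH)

/-- In Version A of generalized one-or-one-or-one-of-both, a position is a
P-position if and only if every pile size is even. -/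
theorem versionA_PPos_iff (G : Multiset ℕ) (hG : 0 ∉ G) :
    PPosA G ↔ ∀ p ∈ G, Even p :=
  (pPosA_iff_and_nPosA_iff G hG).1
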